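/- Let 1 < p < ∞, let Ω ⊆ ℝ^N be a domain of class C^{0,ω} with boundary Γ, and set ψ(t) = min_{0≤s≤r} √(s² + (t−ω(s))²) for t > 0 (r as in the C^{0,ω} definition, with ω(0) := 0). Let 0 < h̲ ≤ h̄ be constants and let w be a bounded function on Ω̄×[0,∞), continuous at every point except possibly on Γ×{0}, which is a viscosity solution of u_t = Δ_p^G u in Ω×(0,∞), satisfies w(x,0) = 0 for x ∈ Ω, satisfies h̲ ≤ w(y,t) ≤ h̄ for all y ∈ Γ and t > 0, and satisfies w > 0 on Ω×(0,∞). Then for every compact K ⊆ Ω̄ there exist C > 0 and t₀ > 0 such that |4t·log w(x,t) + p'·d_Γ(x)²| ≤ C·t·(1 + |log ψ(t)|) for all x ∈ K and 0 < t < t₀. -/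

import Mathlib

open MeasureTheory Metric Set Filter
open scoped Topology ENNReal NNReal Real Classical

noncomputable section

/-- The Hessian matrix of a real-valued function, via the second iterated Fréchet derivative. -/
noncomputable def hess {N : ℕ} (f : EuclideanSpace ℝ (Fin N) → ℝ) (x : EuclideanSpace ℝ (Fin N)) :
    Matrix (Fin N) (Fin N) ℝ :=
  fun i j => iteratedFDeriv ℝ 2 f x ![EuclideanSpace.single i 1, EuclideanSpace.single j 1]

/-- The quadratic form ⟨Xv, v⟩ associated to a matrix. -/
noncomputable def qform {N : ℕ} (X : Matrix (Fin N) (Fin N) ℝ) (v : EuclideanSpace ℝ (Fin N)) : ℝ :=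
  ∑ i, ∑ j, X i j * v j * v i

/-- Smallest eigenvalue (via the Rayleigh quotient) of a symmetric matrix. -/
noncomputable def lamMin {N : ℕ} (X : Matrix (Fin N) (Fin N) ℝ) : ℝ :=
  sInf {r | ∃ v : EuclideanSpace ℝ (Fin N), ‖v‖ = 1 ∧ r = qform X v}

/-- Largest eigenvalue (via the Rayleigh quotient) of a symmetric matrix. -/
noncomputable def lamMax {N : ℕ} (X : Matrix (Fin N) (Fin N) ℝ) : ℝ :=
  sSup {r | ∃ v : EuclideanSpace ℝ (Fin N), ‖v‖ = 1 ∧ r = qform X v}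

/-- F(ξ, X) = (1/p)[tr X + (p−2)⟨Xξ,ξ⟩/|ξ|²]. -/
noncomputable def Fop {N : ℕ} (p : ℝ) (ξ : EuclideanSpace ℝ (Fin N))
    (X : Matrix (Fin N) (Fin N) ℝ) : ℝ :=
  (1/p) * (Matrix.trace X + (p - 2) * qform X ξ / ‖ξ‖^2)

/-- Lower semicontinuous relaxation F_*. -/
noncomputable def Flower {N : ℕ} (p : ℝ) (ξ : EuclideanSpace ℝ (Fin N))
    (X : Matrix (Fin N) (Fin N) ℝ) : ℝ :=
  if ξ = 0 then
    (1/p) * (Matrix.trace X + max (p - 2) 0 * lamMin X + min (p - 2) 0 * lamMax X)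
  else Fop p ξ X

/-- Upper semicontinuous relaxation F^*. -/
noncomputable def Fupper {N : ℕ} (p : ℝ) (ξ : EuclideanSpace ℝ (Fin N))
    (X : Matrix (Fin N) (Fin N) ℝ) : ℝ :=
  if ξ = 0 then
    (1/p) * (Matrix.trace X + min (p - 2) 0 * lamMin X + max (p - 2) 0 * lamMax X)
  else Fop p ξ X

/-- Viscosity solution of `u_t = Δ_p^G u` in `Ω × (0,∞)`. -/
def IsViscositySol {N : ℕ} (p : ℝ) (Ω : Set (EuclideanSpace ℝ (Fin N)))
    (u : EuclideanSpace ℝ (Fin N) → ℝ → ℝ) : Prop :=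
  ContinuousOn (fun q : EuclideanSpace ℝ (Fin N) × ℝ => u q.1 q.2) (Ω ×ˢ Set.Ioi 0) ∧
  (∀ φ : EuclideanSpace ℝ (Fin N) × ℝ → ℝ, ContDiff ℝ 2 φ →
    ∀ x ∈ Ω, ∀ t ∈ Set.Ioi (0:ℝ),
      IsLocalMaxOn (fun q : EuclideanSpace ℝ (Fin N) × ℝ => u q.1 q.2 - φ q)
        (Ω ×ˢ Set.Ioi 0) (x, t) →
      deriv (fun s => φ (x, s)) t ≤
        Fupper p (gradient (fun y => φ (y, t)) x) (hess (fun y => φ (y, t)) x)) ∧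
  (∀ φ : EuclideanSpace ℝ (Fin N) × ℝ → ℝ, ContDiff ℝ 2 φ →
    ∀ x ∈ Ω, ∀ t ∈ Set.Ioi (0:ℝ),
      IsLocalMinOn (fun q : EuclideanSpace ℝ (Fin N) × ℝ => u q.1 q.2 - φ q)
        (Ω ×ˢ Set.Ioi 0) (x, t) →
      Flower p (gradient (fun y => φ (y, t)) x) (hess (fun y => φ (y, t)) x) ≤
        deriv (fun s => φ (x, s)) t)

/-- Bounded (viscosity) solution of problem (P): `u_t = Δ_p^G u` in `Ω × (0,∞)`,
`u = 0` on `Ω × {0}`, `u = 1` on `Γ × (0,∞)`; continuous away from `Γ × {0}`. -/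
def IsSolP {N : ℕ} (p : ℝ) (Ω : Set (EuclideanSpace ℝ (Fin N)))
    (u : EuclideanSpace ℝ (Fin N) → ℝ → ℝ) : Prop :=
  (∃ M : ℝ, ∀ x ∈ closure Ω, ∀ t : ℝ, 0 ≤ t → |u x t| ≤ M) ∧
  (∀ x ∈ closure Ω, ∀ t : ℝ, 0 ≤ t → ¬(x ∈ frontier Ω ∧ t = 0) →
    ContinuousWithinAt (fun q : EuclideanSpace ℝ (Fin N) × ℝ => u q.1 q.2)
      (closure Ω ×ˢ Set.Ici 0) (x, t)) ∧
  IsViscositySol p Ω u ∧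
  (∀ x ∈ Ω, u x 0 = 0) ∧
  (∀ y ∈ frontier Ω, ∀ t : ℝ, 0 < t → u y t = 1)

/-- Viscosity solution of the elliptic equation `u − ε² Δ_p^G u = 0` in `Ω`. -/
def IsEllipticViscositySol {N : ℕ} (p ε : ℝ) (Ω : Set (EuclideanSpace ℝ (Fin N)))
    (u : EuclideanSpace ℝ (Fin N) → ℝ) : Prop :=
  ContinuousOn u Ω ∧
  (∀ φ : EuclideanSpace ℝ (Fin N) → ℝ, ContDiff ℝ 2 φ → ∀ x ∈ Ω,
      IsLocalMaxOn (fun y => u y - φ y) Ω x →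
      φ x - ε^2 * Fupper p (gradient φ x) (hess φ x) ≤ 0) ∧
  (∀ φ : EuclideanSpace ℝ (Fin N) → ℝ, ContDiff ℝ 2 φ → ∀ x ∈ Ω,
      IsLocalMinOn (fun y => u y - φ y) Ω x →
      0 ≤ φ x - ε^2 * Flower p (gradient φ x) (hess φ x))

/-- The complementary error function. -/
noncomputable def Erfc (σ : ℝ) : ℝ := (2 / Real.sqrt π) * ∫ τ in Set.Ioi σ, Real.exp (-τ^2)

/-- The explicit radially symmetric solution `u^ε` of the elliptic problem in the ball `B_R`. -/
noncomputable def uEps (N : ℕ) (p R ε : ℝ) (x : EuclideanSpace ℝ (Fin N)) : ℝ :=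
  (∫ θ in (0:ℝ)..π,
      Real.exp (Real.sqrt (p/(p-1)) * (‖x‖/ε) * Real.cos θ) * (Real.sin θ) ^ (((N:ℝ) - p)/(p-1))) /
  (∫ θ in (0:ℝ)..π,
      Real.exp (Real.sqrt (p/(p-1)) * (R/ε) * Real.cos θ) * (Real.sin θ) ^ (((N:ℝ) - p)/(p-1)))

/-- The first `N−1` coordinates of a point in the coordinate system given by the
rigid motion `g`. -/
noncomputable def proj {N : ℕ} (g : EuclideanSpace ℝ (Fin N) ≃ᵢ EuclideanSpace ℝ (Fin N))
    (y : EuclideanSpace ℝ (Fin N)) : EuclideanSpace ℝ (Fin (N-1)) :=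
  (EuclideanSpace.equiv (Fin (N-1)) ℝ).symm (fun i => g y (Fin.castLE (Nat.sub_le N 1) i))

/-- `Ω` is a domain of class `C^{0,ω}` with parameter `r`, where `iN` is the index of the
last coordinate: around every boundary point, in a suitable Euclidean coordinate system,
`Ω` is the subgraph and `Γ` the graph of a function with modulus of continuity `ω`. -/
def IsC0omega {N : ℕ} (Ω : Set (EuclideanSpace ℝ (Fin N))) (ω : ℝ → ℝ) (r : ℝ)
    (iN : Fin N) : Prop :=
  0 < r ∧
  ∀ x ∈ frontier Ω, ∃ g : EuclideanSpace ℝ (Fin N) ≃ᵢ EuclideanSpace ℝ (Fin N),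
    ∃ φb : EuclideanSpace ℝ (Fin (N-1)) → ℝ,
      (∀ y ∈ Metric.ball x r, (y ∈ Ω ↔ g y iN < φb (proj g y))) ∧
      (∀ y ∈ Metric.ball x r, (y ∈ frontier Ω ↔ g y iN = φb (proj g y))) ∧
      (∀ y ∈ Metric.ball x r ∩ frontier Ω, ∀ z ∈ Metric.ball x r ∩ frontier Ω,
        |φb (proj g y) - φb (proj g z)| ≤ ω (dist (proj g y) (proj g z)))

theorem exists_contDiff_eventuallyEq {V : Type*} [NormedAddCommGroup V] [NormedSpace ℝ V]
    [FiniteDimensional ℝ V] {φ : V → ℝ} {q : V} (hφ : ContDiffAt ℝ 2 φ q) :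
    ∃ φ' : V → ℝ, ContDiff ℝ 2 φ' ∧ φ' =ᶠ[𝓝 q] φ := by
  obtain ⟨ε, hε, hball⟩ := Metric.eventually_nhds_iff_ball.1 (hφ.eventually (by simp))
  let χ : ContDiffBump q := ⟨ε / 4, ε / 2, by positivity, by linarith⟩
  refine ⟨fun y => χ y * φ y, ?_, ?_⟩
  · rw [contDiff_iff_contDiffAt]
    intro y
    by_cases hy : dist y q < ε
    · exact χ.contDiff.contDiffAt.mul (hball y hy)
    · have hzero : (fun y => χ y * φ y) =ᶠ[𝓝 y] fun _ => 0 := by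
        have hfar : ∀ᶠ y' in 𝓝 y, ε / 2 < dist y' q :=
          (continuous_id.dist continuous_const).continuousAt.eventually_const_lt
            (show ε / 2 < dist y q by linarith [not_lt.1 hy])
        filter_upwards [hfar] with y' hy'
        rw [χ.zero_of_le_dist hy'.le, zero_mul]
      exact contDiffAt_const.congr_of_eventuallyEq hzero
  · filter_upwards [χ.eventuallyEq_one] with y hy
    simp [hy]

theorem hasFDerivAt_radial {V : Type*} [NormedAddCommGroup V] [InnerProductSpace ℝ V]
    {P : ℝ → ℝ} {P1 c : ℝ} {x z : V} (h : HasDerivAt P P1 (‖x - z‖ ^ 2)) :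
    HasFDerivAt (fun y => P (‖y - z‖ ^ 2) + c) ((2 * P1) • innerSL ℝ (x - z)) x := by
  have h1 : HasFDerivAt (fun y : V => ‖y - z‖ ^ 2) _ x := ((hasFDerivAt_id x).sub_const z).norm_sq
  refine ((h.comp_hasFDerivAt x h1).add_const c).congr_fderiv ?_
  ext v
  simp
  ring

theorem gradient_radial {N : ℕ} {P : ℝ → ℝ} {P1 c : ℝ} {x z : EuclideanSpace ℝ (Fin N)}
    (h : HasDerivAt P P1 (‖x - z‖ ^ 2)) :
    gradient (fun y => P (‖y - z‖ ^ 2) + c) x = (2 * P1) • (x - z) := by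
  have hg := (hasFDerivAt_radial (c := c) h).hasGradientAt.gradient
  rw [hg, LinearIsometryEquiv.symm_apply_eq]
  ext v
  simp

theorem hess_radial {N : ℕ} {P P1 : ℝ → ℝ} {P2 c : ℝ} {x z : EuclideanSpace ℝ (Fin N)}
    (h : ∀ᶠ q in 𝓝 (‖x - z‖ ^ 2), HasDerivAt P (P1 q) q)
    (h2 : HasDerivAt P1 P2 (‖x - z‖ ^ 2)) (i j : Fin N) :
    hess (fun y => P (‖y - z‖ ^ 2) + c) x i j =
      4 * P2 * ((x - z) i * (x - z) j) + 2 * P1 (‖x - z‖ ^ 2) * (if i = j then 1 else 0) := by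
  have hcont : ContinuousAt (fun y : EuclideanSpace ℝ (Fin N) => ‖y - z‖ ^ 2) x := by fun_prop
  have hfd : fderiv ℝ (fun y => P (‖y - z‖ ^ 2) + c) =ᶠ[𝓝 x]
      fun y => (2 * P1 (‖y - z‖ ^ 2)) • innerSL ℝ (y - z) := by
    filter_upwards [hcont.eventually h] with y hy
    exact (hasFDerivAt_radial hy).fderiv
  have hc : HasFDerivAt (fun y => 2 * P1 (‖y - z‖ ^ 2))
      ((4 * P2) • innerSL ℝ (x - z)) x := by
    have := (hasFDerivAt_radial (c := 0) h2).const_mul 2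
    simp only [add_zero] at this
    refine this.congr_fderiv ?_
    rw [smul_smul]; ring_nf
  have hl : HasFDerivAt (fun y : EuclideanSpace ℝ (Fin N) => innerSL ℝ (y - z)) (innerSL ℝ) x := by
    have := (innerSL ℝ (E := EuclideanSpace ℝ (Fin N))).hasFDerivAt (x := x - z)
    exact this.comp x ((hasFDerivAt_id x).sub_const z)
  have hsmul : HasFDerivAt (fun y => (2 * P1 (‖y - z‖ ^ 2)) • innerSL ℝ (y - z)) _ x := hc.smul hl
  rw [hess, iteratedFDeriv_two_apply, hfd.fderiv_eq, hsmul.fderiv]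
  have hone : innerSL ℝ (EuclideanSpace.single i (1 : ℝ)) (EuclideanSpace.single j 1) =
      if i = j then (1 : ℝ) else 0 := by
    simp [EuclideanSpace.inner_single_left]
  simp [EuclideanSpace.inner_single_right, hone]
  ring

theorem qform_radial {N : ℕ} {X : Matrix (Fin N) (Fin N) ℝ} {A B : ℝ}
    {d : EuclideanSpace ℝ (Fin N)}
    (hX : ∀ i j, X i j = A * (d i * d j) + B * (if i = j then 1 else 0))
    (v : EuclideanSpace ℝ (Fin N)) :
    qform X v = A * (∑ i, d i * v i) ^ 2 + B * ‖v‖ ^ 2 := by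
  have h : ∀ i, ∑ j, X i j * v j * v i = A * (d i * v i) * (∑ j, d j * v j) + B * v i ^ 2 := by
    intro i
    rw [Finset.mul_sum]
    have : ∀ j, X i j * v j * v i =
        A * (d i * v i) * (d j * v j) + (if i = j then B * v i * v j else 0) := by
      intro j
      rw [hX]
      split_ifs <;> ring
    simp only [this, Finset.sum_add_distrib, Finset.sum_ite_eq, Finset.mem_univ, if_true]
    ring
  rw [qform, EuclideanSpace.real_norm_sq_eq]
  simp only [h, Finset.sum_add_distrib, ← Finset.sum_mul, ← Finset.mul_sum]
  ring

theorem trace_radial {N : ℕ} {X : Matrix (Fin N) (Fin N) ℝ} {A B : ℝ}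
    {d : EuclideanSpace ℝ (Fin N)}
    (hX : ∀ i j, X i j = A * (d i * d j) + B * (if i = j then 1 else 0)) :
    X.trace = A * ‖d‖ ^ 2 + N * B := by
  simp only [Matrix.trace, Matrix.diag, hX, EuclideanSpace.real_norm_sq_eq]
  simp [Finset.sum_add_distrib, Finset.mul_sum, sq]

theorem operator_radial {N : ℕ} (hN : 0 < N) (p : ℝ) {X : Matrix (Fin N) (Fin N) ℝ} {P1 P2 : ℝ}
    {d : EuclideanSpace ℝ (Fin N)} (hP1 : P1 ≠ 0)
    (hX : ∀ i j, X i j = 4 * P2 * (d i * d j) + 2 * P1 * (if i = j then 1 else 0)) :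
    Fupper p ((2 * P1) • d) X =
        1 / p * (4 * (p - 1) * P2 * ‖d‖ ^ 2 + 2 * (N + p - 2) * P1) ∧
      Flower p ((2 * P1) • d) X =
        1 / p * (4 * (p - 1) * P2 * ‖d‖ ^ 2 + 2 * (N + p - 2) * P1) := by
  have hq := qform_radial hX
  have ht := trace_radial hX
  by_cases hd : d = 0
  · subst hd
    have hset : {r | ∃ v : EuclideanSpace ℝ (Fin N), ‖v‖ = 1 ∧ r = qform X v} = {2 * P1} := by
      ext r
      constructor
      · rintro ⟨v, hv, rfl⟩
        simp [hq, hv]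
      · rintro rfl
        refine ⟨EuclideanSpace.single ⟨0, hN⟩ 1, by simp, ?_⟩
        simp [hq]
    have hmm := min_add_max (p - 2) 0
    simp only [Fupper, Flower, smul_zero, if_true, lamMin, lamMax, hset, csInf_singleton,
      csSup_singleton, ht, norm_zero]
    constructor <;> linear_combination (1 / p * (2 * P1)) * hmm
  · have hne : (2 * P1) • d ≠ 0 := by simp [hd, hP1]
    have hdn : ‖d‖ ≠ 0 := norm_ne_zero_iff.2 hd
    have hsum : ∑ i, d i * ((2 * P1) • d) i = 2 * P1 * ‖d‖ ^ 2 := by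
      rw [EuclideanSpace.real_norm_sq_eq, Finset.mul_sum]
      refine Finset.sum_congr rfl fun i _ => ?_
      simp
      ring
    have hnorm : ‖(2 * P1) • d‖ ^ 2 = (2 * P1) ^ 2 * ‖d‖ ^ 2 := by
      rw [norm_smul, mul_pow, Real.norm_eq_abs, sq_abs]
    have hF : Fop p ((2 * P1) • d) X =
        1 / p * (4 * (p - 1) * P2 * ‖d‖ ^ 2 + 2 * (N + p - 2) * P1) := by
      rw [Fop, hq, ht, hsum, hnorm]
      congr 1
      field_simp
      ring
    simp only [Fupper, Flower, if_neg hne, hF, and_self]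

/-- A locally `C²` function that is radial in space extends to a global test function whose
derivatives at the given point are those of the radial profile. -/
theorem exists_test_radial {N : ℕ} (hN : 0 < N) (p : ℝ)
    {φ : EuclideanSpace ℝ (Fin N) × ℝ → ℝ} {x z : EuclideanSpace ℝ (Fin N)} {t : ℝ}
    (hφ : ContDiffAt ℝ 2 φ (x, t))
    {P P1 : ℝ → ℝ} {P2 c D : ℝ} (hrad : ∀ y, φ (y, t) = P (‖y - z‖ ^ 2) + c)
    (h1 : ∀ᶠ q in 𝓝 (‖x - z‖ ^ 2), HasDerivAt P (P1 q) q)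
    (h2 : HasDerivAt P1 P2 (‖x - z‖ ^ 2)) (hne : P1 (‖x - z‖ ^ 2) ≠ 0)
    (hD : HasDerivAt (fun s => φ (x, s)) D t) :
    ∃ φ' : EuclideanSpace ℝ (Fin N) × ℝ → ℝ, ContDiff ℝ 2 φ' ∧ φ' =ᶠ[𝓝 (x, t)] φ ∧
      deriv (fun s => φ' (x, s)) t = D ∧
      Fupper p (gradient (fun y => φ' (y, t)) x) (hess (fun y => φ' (y, t)) x) =
        1 / p * (4 * (p - 1) * P2 * ‖x - z‖ ^ 2 + 2 * (N + p - 2) * P1 (‖x - z‖ ^ 2)) ∧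
      Flower p (gradient (fun y => φ' (y, t)) x) (hess (fun y => φ' (y, t)) x) =
        1 / p * (4 * (p - 1) * P2 * ‖x - z‖ ^ 2 + 2 * (N + p - 2) * P1 (‖x - z‖ ^ 2)) := by
  obtain ⟨φ', hφ', heq⟩ := exists_contDiff_eventuallyEq hφ
  have htime : (fun s => φ' (x, s)) =ᶠ[𝓝 t] fun s => φ (x, s) :=
    (show ContinuousAt (fun s : ℝ => (x, s)) t by fun_prop).eventually heq
  have hspace : (fun y => φ' (y, t)) =ᶠ[𝓝 x] fun y => P (‖y - z‖ ^ 2) + c := by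
    filter_upwards [(show ContinuousAt (fun y => (y, t)) x by fun_prop).eventually heq] with y hy
    rw [hy, hrad]
  have hgrad : gradient (fun y => φ' (y, t)) x = (2 * P1 (‖x - z‖ ^ 2)) • (x - z) := by
    rw [gradient, hspace.fderiv_eq]
    exact gradient_radial h1.self_of_nhds
  have hhess : hess (fun y => φ' (y, t)) x = hess (fun y => P (‖y - z‖ ^ 2) + c) x := by
    funext i j
    rw [hess, (hspace.iteratedFDeriv ℝ 2).self_of_nhds, hess]
  refine ⟨φ', hφ', heq, htime.deriv_eq.trans hD.deriv, ?_⟩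
  rw [hgrad, hhess]
  exact operator_radial hN p hne (hess_radial h1 h2)

theorem IsViscositySol.le_of_isLocalMax_radial {N : ℕ} (hN : 0 < N) {p : ℝ}
    {Ω : Set (EuclideanSpace ℝ (Fin N))} {u : EuclideanSpace ℝ (Fin N) → ℝ → ℝ}
    (hu : IsViscositySol p Ω u) {φ : EuclideanSpace ℝ (Fin N) × ℝ → ℝ}
    {x z : EuclideanSpace ℝ (Fin N)} {t : ℝ} (hx : x ∈ Ω) (ht : 0 < t)
    (hφ : ContDiffAt ℝ 2 φ (x, t))
    (hmax : IsLocalMax (fun q : EuclideanSpace ℝ (Fin N) × ℝ => u q.1 q.2 - φ q) (x, t))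
    {P P1 : ℝ → ℝ} {P2 c D : ℝ} (hrad : ∀ y, φ (y, t) = P (‖y - z‖ ^ 2) + c)
    (h1 : ∀ᶠ q in 𝓝 (‖x - z‖ ^ 2), HasDerivAt P (P1 q) q)
    (h2 : HasDerivAt P1 P2 (‖x - z‖ ^ 2)) (hne : P1 (‖x - z‖ ^ 2) ≠ 0)
    (hD : HasDerivAt (fun s => φ (x, s)) D t) :
    D ≤ 1 / p * (4 * (p - 1) * P2 * ‖x - z‖ ^ 2 + 2 * (N + p - 2) * P1 (‖x - z‖ ^ 2)) := by
  obtain ⟨φ', hφ', heq, hder, hup, -⟩ := exists_test_radial hN p hφ hrad h1 h2 hne hD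
  have hmax' : IsLocalMax (fun q : EuclideanSpace ℝ (Fin N) × ℝ => u q.1 q.2 - φ' q) (x, t) := by
    refine hmax.congr ?_
    filter_upwards [heq] with q hq
    rw [hq]
  rw [← hder, ← hup]
  exact hu.2.1 φ' hφ' x hx t ht (hmax'.on _)

theorem IsViscositySol.le_of_isLocalMin_radial {N : ℕ} (hN : 0 < N) {p : ℝ}
    {Ω : Set (EuclideanSpace ℝ (Fin N))} {u : EuclideanSpace ℝ (Fin N) → ℝ → ℝ}
    (hu : IsViscositySol p Ω u) {φ : EuclideanSpace ℝ (Fin N) × ℝ → ℝ}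
    {x z : EuclideanSpace ℝ (Fin N)} {t : ℝ} (hx : x ∈ Ω) (ht : 0 < t)
    (hφ : ContDiffAt ℝ 2 φ (x, t))
    (hmin : IsLocalMin (fun q : EuclideanSpace ℝ (Fin N) × ℝ => u q.1 q.2 - φ q) (x, t))
    {P P1 : ℝ → ℝ} {P2 c D : ℝ} (hrad : ∀ y, φ (y, t) = P (‖y - z‖ ^ 2) + c)
    (h1 : ∀ᶠ q in 𝓝 (‖x - z‖ ^ 2), HasDerivAt P (P1 q) q)
    (h2 : HasDerivAt P1 P2 (‖x - z‖ ^ 2)) (hne : P1 (‖x - z‖ ^ 2) ≠ 0)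
    (hD : HasDerivAt (fun s => φ (x, s)) D t) :
    1 / p * (4 * (p - 1) * P2 * ‖x - z‖ ^ 2 + 2 * (N + p - 2) * P1 (‖x - z‖ ^ 2)) ≤ D := by
  obtain ⟨φ', hφ', heq, hder, -, hlo⟩ := exists_test_radial hN p hφ hrad h1 h2 hne hD
  have hmin' : IsLocalMin (fun q : EuclideanSpace ℝ (Fin N) × ℝ => u q.1 q.2 - φ' q) (x, t) := by
    refine hmin.congr ?_
    filter_upwards [heq] with q hq
    rw [hq]
  rw [← hder, ← hlo]
  exact hu.2.2 φ' hφ' x hx t ht (hmin'.on _)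

theorem mul_log_div_sub_le {a b s : ℝ} (ha : 0 < a) (hb : 0 < b) (hs : 0 < s) :
    a * Real.log (b / a) - a * Real.log s - b / s ≤ 0 := by
  have h := Real.log_le_sub_one_of_pos (show 0 < b / a / s by positivity)
  rw [Real.log_div (by positivity) hs.ne'] at h
  have h' := mul_le_mul_of_nonneg_left h ha.le
  have : a * (b / a / s - 1) = b / s - a := by field_simp
  linarith

theorem exists_log_sub_le {a b : ℝ} (ha : 0 < a) (hb : 0 < b) (L κ : ℝ) :
    ∃ τ > 0, ∀ s, 0 < s → s ≤ τ → L - a * Real.log s - b / s ≤ κ := by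
  set c := |L - a * Real.log (b / 2 / a) - κ| + 1 with hc
  have hcpos : 0 < c := by positivity
  refine ⟨b / (2 * c), by positivity, fun s hs hsτ => ?_⟩
  have h := mul_log_div_sub_le ha (half_pos hb) hs
  have h2 : c ≤ b / 2 / s := by
    rw [le_div_iff₀ hs]
    rw [le_div_iff₀ (by positivity)] at hsτ
    linarith
  have h3 : b / s = b / 2 / s + b / 2 / s := by field_simp; norm_num
  have h4 := le_abs_self (L - a * Real.log (b / 2 / a) - κ)
  linarith

theorem hasDerivAt_div_sub {η T t : ℝ} (ht : t < T) :
    HasDerivAt (fun s => η / (T - s)) (η / (T - t) ^ 2) t := by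
  refine ((hasDerivAt_const t η).div ((hasDerivAt_id t).const_sub T)
    (sub_pos.2 ht).ne').congr_deriv ?_
  simp

/-- The radial heat kernel is a solution, so after subtracting a penalty increasing in time it
cannot touch a viscosity solution from below. -/
theorem IsViscositySol.not_isLocalMin_kernel {N : ℕ} (hN : 0 < N) {p : ℝ} (hp : 1 < p)
    {Ω : Set (EuclideanSpace ℝ (Fin N))} {w : EuclideanSpace ℝ (Fin N) → ℝ → ℝ}
    (hw : IsViscositySol p Ω w) {a β : ℝ} (ha : a = (N + p - 2) / (2 * (p - 1)))
    (hβ : β = p / (4 * (p - 1))) {x z : EuclideanSpace ℝ (Fin N)} (hx : x ∈ Ω)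
    {t T η L : ℝ} (ht : 0 < t) (htT : t < T) (hη : 0 < η) :
    ¬ IsLocalMin (fun q : EuclideanSpace ℝ (Fin N) × ℝ => w q.1 q.2 -
      (Real.exp (L - a * Real.log q.2 - β * ‖q.1 - z‖ ^ 2 / q.2) - η / (T - q.2))) (x, t) := by
  intro hmin
  have hp1 : 0 < p - 1 := by linarith
  have hβpos : 0 < β := by rw [hβ]; positivity
  set E := Real.exp (L - a * Real.log t - β * ‖x - z‖ ^ 2 / t) with hE
  have hEpos : 0 < E := Real.exp_pos _
  have hφ : ContDiffAt ℝ 2 (fun q : EuclideanSpace ℝ (Fin N) × ℝ =>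
      Real.exp (L - a * Real.log q.2 - β * ‖q.1 - z‖ ^ 2 / q.2) - η / (T - q.2)) (x, t) := by
    have hsq : ContDiffAt ℝ 2 (fun q : EuclideanSpace ℝ (Fin N) × ℝ => ‖q.1 - z‖ ^ 2) (x, t) :=
      (contDiffAt_fst.sub contDiffAt_const).norm_sq ℝ
    exact ((contDiffAt_const.sub (contDiffAt_const.mul (contDiffAt_snd.log ht.ne'))).sub
      ((contDiffAt_const.mul hsq).div contDiffAt_snd ht.ne')).exp.sub
      (contDiffAt_const.div (contDiffAt_const.sub contDiffAt_snd) (sub_pos.2 htT).ne')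
  have h1 : ∀ q, HasDerivAt (fun q => Real.exp (L - a * Real.log t - β * q / t))
      (-(β / t) * Real.exp (L - a * Real.log t - β * q / t)) q := fun q => by
    have := ((((hasDerivAt_id q).const_mul β).div_const t).const_sub (L - a * Real.log t)).exp
    refine this.congr_deriv ?_
    simp
    ring
  have h2 := (h1 (‖x - z‖ ^ 2)).const_mul (-(β / t))
  have hD : HasDerivAt (fun s => Real.exp (L - a * Real.log s - β * ‖x - z‖ ^ 2 / s) - η / (T - s))
      (E * (-(a / t) + β * ‖x - z‖ ^ 2 / t ^ 2) - η / (T - t) ^ 2) t := by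
    have hlog := ((Real.hasDerivAt_log ht.ne').const_mul a).const_sub L
    have hdiv := (hasDerivAt_inv ht.ne').const_mul (β * ‖x - z‖ ^ 2)
    refine ((hlog.sub hdiv).exp.sub (hasDerivAt_div_sub htT)).congr_deriv ?_
    simp only [← div_eq_mul_inv, ← hE, Pi.sub_apply]
    ring
  have key := hw.le_of_isLocalMin_radial hN (z := z) (c := -(η / (T - t))) hx ht hφ hmin
    (fun y => sub_eq_add_neg _ _) (Eventually.of_forall h1) h2
    (mul_ne_zero (neg_ne_zero.2 (div_pos hβpos ht).ne') (Real.exp_ne_zero _)) hD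
  have hsame : 1 / p * (4 * (p - 1) * (-(β / t) * (-(β / t) * E)) * ‖x - z‖ ^ 2 +
      2 * (N + p - 2) * (-(β / t) * E)) = E * (-(a / t) + β * ‖x - z‖ ^ 2 / t ^ 2) := by
    rw [ha, hβ]
    field_simp
    ring
  rw [← hE, hsame] at key
  have : 0 < η / (T - t) ^ 2 := by have := sub_pos.2 htT; positivity
  linarith

/-- Lower bound by a multiple of the heat kernel centred at a point outside the domain. -/
theorem IsViscositySol.kernel_le_log {N : ℕ} (hN : 0 < N) {p : ℝ} (hp : 1 < p)
    {Ω : Set (EuclideanSpace ℝ (Fin N))} (hΩ : IsOpen Ω) {w : EuclideanSpace ℝ (Fin N) → ℝ → ℝ}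
    (hw : IsViscositySol p Ω w)
    (hcont : ContinuousOn (fun q : EuclideanSpace ℝ (Fin N) × ℝ => w q.1 q.2)
      (closure Ω ×ˢ Ioi 0)) {m : ℝ} (hm : 0 < m)
    (hbd : ∀ y ∈ frontier Ω, ∀ t : ℝ, 0 < t → m ≤ w y t)
    (hpos : ∀ x ∈ Ω, ∀ t : ℝ, 0 < t → 0 < w x t)
    {a β : ℝ} (ha : a = (N + p - 2) / (2 * (p - 1))) (hβ : β = p / (4 * (p - 1)))
    {z : EuclideanSpace ℝ (Fin N)} {ρ : ℝ} (hρ : 0 < ρ) (hz : ∀ q ∈ closure Ω, ρ ≤ ‖q - z‖)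
    {x₀ : EuclideanSpace ℝ (Fin N)} (hx₀ : x₀ ∈ Ω) {T : ℝ} (hT : 0 < T) :
    Real.log m + a * Real.log (β * ρ ^ 2 / a) - a * Real.log T - β * ‖x₀ - z‖ ^ 2 / T ≤
      Real.log (w x₀ T) := by
  have hp1 : 0 < p - 1 := by linarith
  have hβpos : 0 < β := by rw [hβ]; positivity
  have hN1 : (1 : ℝ) ≤ N := by exact_mod_cast hN
  have hapos : 0 < a := by rw [ha]; apply div_pos <;> linarith
  have hbpos : 0 < β * ρ ^ 2 := by positivity
  rw [Real.le_log_iff_exp_le (hpos x₀ hx₀ T hT)]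
  by_contra! hlt
  set L := Real.log m + a * Real.log (β * ρ ^ 2 / a) with hL
  set v : EuclideanSpace ℝ (Fin N) × ℝ → ℝ :=
    fun q => Real.exp (L - a * Real.log q.2 - β * ‖q.1 - z‖ ^ 2 / q.2) with hv
  have hmono : ∀ y ∈ closure Ω, ∀ s : ℝ, 0 < s →
      L - a * Real.log s - β * ‖y - z‖ ^ 2 / s ≤ L - a * Real.log s - β * ρ ^ 2 / s := by
    intro y hy s hs
    have := hz y hy
    gcongr
  have hvm : ∀ y ∈ closure Ω, ∀ s : ℝ, 0 < s → v (y, s) ≤ m := by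
    intro y hy s hs
    rw [← Real.exp_log hm, hv]
    apply Real.exp_le_exp.2
    have h1 := mul_log_div_sub_le hapos hbpos hs
    have h2 := hmono y hy s hs
    simp only
    linarith
  set δ := v (x₀, T) - w x₀ T with hδ
  have hδpos : 0 < δ := sub_pos.2 hlt
  obtain ⟨τ', hτ'pos, hτ'⟩ := exists_log_sub_le hapos hbpos L (Real.log (δ / 4))
  set τ := min τ' (T / 2) with hτ
  have hτpos : 0 < τ := lt_min hτ'pos (by linarith)
  have hτT : τ < T := (min_le_right _ _).trans_lt (by linarith)
  set σ := min (1 / 2) (δ / 2 / m) with hσ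
  have hσpos : 0 < σ := lt_min (by norm_num) (by positivity)
  have hσ1 : σ ≤ 1 / 2 := min_le_left _ _
  have hσm : m ≤ δ / 2 / σ := by
    rw [le_div_iff₀ hσpos, mul_comm, ← le_div_iff₀ hm]
    exact min_le_right _ _
  set A := |L - a * Real.log τ - Real.log (δ / 4)| with hA
  set R := 1 + ‖x₀ - z‖ + (T + 1) / β * A with hR
  have hR1 : 1 ≤ R := by
    have : 0 ≤ (T + 1) / β * A := by positivity
    linarith [norm_nonneg (x₀ - z)]
  set φ : EuclideanSpace ℝ (Fin N) × ℝ → ℝ := fun q => v q - δ / 2 / (T + 1 - q.2) with hφ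
  set S := (closure Ω ∩ closedBall z R) ×ˢ Icc τ (T + 1 - σ) with hS
  have hScomp : IsCompact S :=
    ((isCompact_closedBall z R).inter_left isClosed_closure).prod isCompact_Icc
  have hmem : (x₀, T) ∈ S := by
    refine ⟨⟨subset_closure hx₀, ?_⟩, hτT.le, by simp only; linarith⟩
    rw [mem_closedBall, dist_eq_norm]
    have : 0 ≤ (T + 1) / β * A := by positivity
    linarith
  have hvcont : ContinuousOn v S := by
    refine Real.continuous_exp.comp_continuousOn ?_
    have hne : ∀ q ∈ S, q.2 ≠ 0 := fun q hq => (hτpos.trans_le hq.2.1).ne'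
    exact (continuousOn_const.sub (continuousOn_const.mul (continuousOn_snd.log hne))).sub
      (ContinuousOn.div (by fun_prop) continuousOn_snd hne)
  have hpen : ContinuousOn (fun q : EuclideanSpace ℝ (Fin N) × ℝ => δ / 2 / (T + 1 - q.2)) S :=
    continuousOn_const.div (by fun_prop) fun q hq => by linarith [hq.2.2]
  have hfcont : ContinuousOn
      (fun q : EuclideanSpace ℝ (Fin N) × ℝ => w q.1 q.2 - φ q) S :=
    (hcont.mono (prod_mono inter_subset_left fun s hs => hτpos.trans_le hs.1)).sub
      (hvcont.sub hpen)
  obtain ⟨⟨x₁, t₁⟩, hx₁, hmin⟩ := hScomp.exists_isMinOn ⟨_, hmem⟩ hfcont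
  obtain ⟨⟨hx₁Ω, hx₁R⟩, ht₁τ, ht₁σ⟩ := hx₁
  simp only at hx₁Ω hx₁R ht₁τ ht₁σ
  have ht₁ : 0 < t₁ := hτpos.trans_le ht₁τ
  have hval : w x₁ t₁ - φ (x₁, t₁) ≤ -(δ / 2) := by
    have h : w x₁ t₁ - φ (x₁, t₁) ≤ w x₀ T - φ (x₀, T) := hmin hmem
    have h' : φ (x₀, T) = v (x₀, T) - δ / 2 := by simp [hφ]
    linarith
  have hφval : φ (x₁, t₁) = v (x₁, t₁) - δ / 2 / (T + 1 - t₁) := rfl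
  have hpenpos : 0 < δ / 2 / (T + 1 - t₁) := by
    have : 0 < T + 1 - t₁ := by linarith
    positivity
  have hx₁in : x₁ ∈ Ω := by
    by_contra hnot
    have hfr : x₁ ∈ frontier Ω := by
      rw [hΩ.frontier_eq]
      exact ⟨hx₁Ω, hnot⟩
    linarith [hbd x₁ hfr t₁ ht₁, hvm x₁ hx₁Ω t₁ ht₁]
  have hwpos := hpos x₁ hx₁in t₁ ht₁
  have hvbig : δ / 4 < v (x₁, t₁) := by linarith
  have ht₁τ' : τ < t₁ := by
    refine lt_of_le_of_ne ht₁τ fun heq => ?_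
    have h1 := hτ' t₁ ht₁ (heq ▸ min_le_left _ _)
    have h2 := hmono x₁ hx₁Ω t₁ ht₁
    have h3 := Real.exp_le_exp.2 (h2.trans h1)
    rw [Real.exp_log (by positivity)] at h3
    exact absurd hvbig (not_lt.2 h3)
  have ht₁σ' : t₁ < T + 1 - σ := by
    refine lt_of_le_of_ne ht₁σ fun heq => ?_
    have h1 : T + 1 - t₁ = σ := by linarith
    rw [h1] at hφval
    linarith [hvm x₁ hx₁Ω t₁ ht₁]
  have hx₁R' : x₁ ∈ ball z R := by
    rw [mem_closedBall, dist_eq_norm] at hx₁R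
    rw [mem_ball, dist_eq_norm]
    refine lt_of_le_of_ne hx₁R fun heq => ?_
    have h1 : Real.log τ ≤ Real.log t₁ := Real.log_le_log hτpos ht₁τ
    have h2 : A ≤ β * ‖x₁ - z‖ ^ 2 / t₁ := by
      rw [heq, le_div_iff₀ ht₁]
      have hle : (T + 1) / β * A ≤ R := by linarith [norm_nonneg (x₀ - z)]
      have hle2 : (T + 1) * A ≤ β * R := by
        have := mul_le_mul_of_nonneg_left hle hβpos.le
        rwa [show β * ((T + 1) / β * A) = (T + 1) * A by field_simp] at this
      have hA0 : 0 ≤ A := abs_nonneg _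
      have hRR : R ≤ R ^ 2 := by nlinarith
      calc A * t₁ ≤ A * (T + 1) := by gcongr; linarith
        _ = (T + 1) * A := mul_comm _ _
        _ ≤ β * R := hle2
        _ ≤ β * R ^ 2 := by gcongr
    have h3 : L - a * Real.log t₁ - β * ‖x₁ - z‖ ^ 2 / t₁ ≤ Real.log (δ / 4) := by
      have := mul_le_mul_of_nonneg_left h1 hapos.le
      have := le_abs_self (L - a * Real.log τ - Real.log (δ / 4))
      linarith
    have h4 := Real.exp_le_exp.2 h3
    rw [Real.exp_log (by positivity)] at h4
    exact absurd hvbig (not_lt.2 h4)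
  have hnhds : S ∈ 𝓝 (x₁, t₁) := by
    refine prod_mem_nhds (Filter.inter_mem (Filter.mem_of_superset (hΩ.mem_nhds hx₁in)
      subset_closure) ?_) (Icc_mem_nhds ht₁τ' ht₁σ')
    exact Filter.mem_of_superset (isOpen_ball.mem_nhds hx₁R') ball_subset_closedBall
  exact hw.not_isLocalMin_kernel hN hp ha hβ hx₁in ht₁ (by linarith) (half_pos hδpos)
    (hmin.isLocalMin hnhds)

/-- The profile `H` with `exp (H (‖x‖²))` a radial supersolution of `Δ_p^G f = (p - 1) / p * l² * f`. -/
noncomputable def barrierProfile (c l q : ℝ) : ℝ :=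
  (√(c ^ 2 + 4 * l ^ 2 * q) - c * Real.log (c + √(c ^ 2 + 4 * l ^ 2 * q))) / 2

theorem hasDerivAt_sqrt_profile {c l q : ℝ} (hq : 0 < c ^ 2 + 4 * l ^ 2 * q) :
    HasDerivAt (fun q => √(c ^ 2 + 4 * l ^ 2 * q))
      (2 * l ^ 2 / √(c ^ 2 + 4 * l ^ 2 * q)) q := by
  refine ((((hasDerivAt_id q).const_mul (4 * l ^ 2)).const_add (c ^ 2)).sqrt hq.ne').congr_deriv ?_
  simp only [id, mul_one]
  ring

theorem hasDerivAt_barrierProfile {c l q : ℝ} (hc : 0 < c) (hq : 0 < c ^ 2 + 4 * l ^ 2 * q) :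
    HasDerivAt (barrierProfile c l) (l ^ 2 / (c + √(c ^ 2 + 4 * l ^ 2 * q))) q := by
  have hy := Real.sqrt_pos.2 hq
  have h := hasDerivAt_sqrt_profile hq
  refine ((h.sub (((h.const_add c).log (by positivity)).const_mul c)).div_const 2).congr_deriv ?_
  generalize √(c ^ 2 + 4 * l ^ 2 * q) = y at hy ⊢
  field_simp
  ring

theorem hasDerivAt_deriv_barrierProfile {c l q : ℝ} (hc : 0 < c)
    (hq : 0 < c ^ 2 + 4 * l ^ 2 * q) :
    HasDerivAt (fun q => l ^ 2 / (c + √(c ^ 2 + 4 * l ^ 2 * q)))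
      (-(2 * l ^ 4 / (√(c ^ 2 + 4 * l ^ 2 * q) * (c + √(c ^ 2 + 4 * l ^ 2 * q)) ^ 2))) q := by
  have hy := Real.sqrt_pos.2 hq
  refine ((hasDerivAt_const q (l ^ 2)).div ((hasDerivAt_sqrt_profile hq).const_add c)
    (by positivity)).congr_deriv ?_
  field_simp
  ring

/-- The barrier built from `barrierProfile`, with a penalty increasing in time, is a strict
supersolution and cannot touch a viscosity solution from above. -/
theorem IsViscositySol.not_isLocalMax_barrier {N : ℕ} (hN : 0 < N) {p : ℝ} (hp : 1 < p)
    {Ω : Set (EuclideanSpace ℝ (Fin N))} {w : EuclideanSpace ℝ (Fin N) → ℝ → ℝ}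
    (hw : IsViscositySol p Ω w) {c : ℝ} (hc : c = (N + p - 2) / (p - 1))
    {x z : EuclideanSpace ℝ (Fin N)} (hx : x ∈ Ω)
    {t T η L l : ℝ} (hl : 0 < l) (ht : 0 < t) (htT : t < T) (hη : 0 < η) :
    ¬ IsLocalMax (fun q : EuclideanSpace ℝ (Fin N) × ℝ => w q.1 q.2 -
      (Real.exp (L + (p - 1) / p * l ^ 2 * q.2 + barrierProfile c l (‖q.1 - z‖ ^ 2)) +
        η / (T - q.2))) (x, t) := by
  intro hmax
  have hp1 : 0 < p - 1 := by linarith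
  have hN1 : (1 : ℝ) ≤ N := by exact_mod_cast hN
  have hcpos : 0 < c := by rw [hc]; apply div_pos <;> linarith
  set Q := ‖x - z‖ ^ 2 with hQ
  have hQ0 : 0 ≤ Q := by positivity
  have hrad : 0 < c ^ 2 + 4 * l ^ 2 * Q := by positivity
  set E := Real.exp (L + (p - 1) / p * l ^ 2 * t + barrierProfile c l Q) with hE
  have hEpos : 0 < E := Real.exp_pos _
  set y := √(c ^ 2 + 4 * l ^ 2 * Q) with hy
  have hypos : 0 < y := Real.sqrt_pos.2 hrad
  have hφ : ContDiffAt ℝ 2 (fun q : EuclideanSpace ℝ (Fin N) × ℝ =>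
      Real.exp (L + (p - 1) / p * l ^ 2 * q.2 + barrierProfile c l (‖q.1 - z‖ ^ 2)) +
        η / (T - q.2)) (x, t) := by
    have hsq : ContDiffAt ℝ 2 (fun q : EuclideanSpace ℝ (Fin N) × ℝ => ‖q.1 - z‖ ^ 2) (x, t) :=
      (contDiffAt_fst.sub contDiffAt_const).norm_sq ℝ
    have hsqrt : ContDiffAt ℝ 2 (fun q : EuclideanSpace ℝ (Fin N) × ℝ =>
        √(c ^ 2 + 4 * l ^ 2 * ‖q.1 - z‖ ^ 2)) (x, t) :=
      (contDiffAt_const.add (contDiffAt_const.mul hsq)).sqrt hrad.ne'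
    have hprof : ContDiffAt ℝ 2 (fun q : EuclideanSpace ℝ (Fin N) × ℝ =>
        barrierProfile c l (‖q.1 - z‖ ^ 2)) (x, t) :=
      (hsqrt.sub (contDiffAt_const.mul ((contDiffAt_const.add hsqrt).log
        (add_pos hcpos hypos).ne'))).div_const 2
    exact ((contDiffAt_const.add (contDiffAt_const.mul contDiffAt_snd)).add hprof).exp.add
      (contDiffAt_const.div (contDiffAt_const.sub contDiffAt_snd) (sub_pos.2 htT).ne')
  have h1 : ∀ q, 0 < c ^ 2 + 4 * l ^ 2 * q →
      HasDerivAt (fun q => Real.exp (L + (p - 1) / p * l ^ 2 * t + barrierProfile c l q))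
        (Real.exp (L + (p - 1) / p * l ^ 2 * t + barrierProfile c l q) *
          (l ^ 2 / (c + √(c ^ 2 + 4 * l ^ 2 * q)))) q := fun q hq =>
    ((hasDerivAt_barrierProfile hcpos hq).const_add _).exp
  have h1' : ∀ᶠ q in 𝓝 Q, 0 < c ^ 2 + 4 * l ^ 2 * q :=
    (show ContinuousAt (fun q => c ^ 2 + 4 * l ^ 2 * q) Q by fun_prop).eventually_const_lt hrad
  have h2 := (h1 Q hrad).mul (hasDerivAt_deriv_barrierProfile hcpos hrad)
  have hD : HasDerivAt (fun s => Real.exp (L + (p - 1) / p * l ^ 2 * s + barrierProfile c l Q) +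
      η / (T - s)) (E * ((p - 1) / p * l ^ 2) + η / (T - t) ^ 2) t := by
    have hexp := ((((hasDerivAt_id t).const_mul ((p - 1) / p * l ^ 2)).const_add L).add_const
      (barrierProfile c l Q)).exp
    refine (hexp.add (hasDerivAt_div_sub htT)).congr_deriv ?_
    simp [hE]
  have key := hw.le_of_isLocalMax_radial hN (z := z) (c := η / (T - t)) hx ht hφ hmax
    (fun y => rfl) (h1'.mono h1) h2
    (mul_pos (Real.exp_pos _) (div_pos (by positivity) (add_pos hcpos hypos))).ne' hD
  simp only [← hQ, ← hE, ← hy] at key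
  have hysq : y ^ 2 = c ^ 2 + 4 * l ^ 2 * Q := Real.sq_sqrt hrad.le
  have hNc : (N : ℝ) + p - 2 = c * (p - 1) := by rw [hc]; field_simp
  have hmain : 4 * Q * (l ^ 2 / (c + y)) ^ 2 + 2 * c * (l ^ 2 / (c + y)) = l ^ 2 := by
    field_simp
    linear_combination (-1) * hysq
  have hneg : 0 ≤ 4 * (p - 1) * Q * E * (2 * l ^ 4 / (y * (c + y) ^ 2)) := by positivity
  have hle : 1 / p * (4 * (p - 1) * (E * (l ^ 2 / (c + y)) * (l ^ 2 / (c + y)) +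
      E * -(2 * l ^ 4 / (y * (c + y) ^ 2))) * Q +
      2 * (N + p - 2) * (E * (l ^ 2 / (c + y)))) ≤ E * ((p - 1) / p * l ^ 2) := by
    rw [hNc]
    have hp0 : 0 < p := by linarith
    rw [show E * ((p - 1) / p * l ^ 2) = 1 / p * ((p - 1) * E * l ^ 2) by ring]
    refine mul_le_mul_of_nonneg_left ?_ (by positivity)
    have := congrArg (fun r => (p - 1) * E * r) hmain
    linarith
  have hpen : 0 < η / (T - t) ^ 2 := by have := sub_pos.2 htT; positivity
  linarith

/-- Upper bound at the centre of a ball contained in the domain. -/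
theorem IsViscositySol.le_barrier {N : ℕ} (hN : 0 < N) {p : ℝ} (hp : 1 < p)
    {Ω : Set (EuclideanSpace ℝ (Fin N))} {w : EuclideanSpace ℝ (Fin N) → ℝ → ℝ}
    (hw : IsViscositySol p Ω w)
    (hcont : ContinuousOn (fun q : EuclideanSpace ℝ (Fin N) × ℝ => w q.1 q.2) (Ω ×ˢ Ici 0))
    {B : ℝ} (hB0 : 0 ≤ B) (hB : ∀ x ∈ Ω, ∀ t : ℝ, 0 ≤ t → w x t ≤ B)
    (hinit : ∀ x ∈ Ω, w x 0 = 0)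
    {c : ℝ} (hc : c = (N + p - 2) / (p - 1)) {l : ℝ} (hl : 0 < l)
    {x₀ : EuclideanSpace ℝ (Fin N)} {R : ℝ} (hR : 0 < R) (hball : ball x₀ R ⊆ Ω)
    {T : ℝ} (hT : 0 < T) :
    w x₀ T ≤ Real.exp (Real.log (B + 1) - barrierProfile c l (R ^ 2) +
      (p - 1) / p * l ^ 2 * T + barrierProfile c l 0) := by
  have hp1 : 0 < p - 1 := by linarith
  have hp0 : 0 < p := by linarith
  have hN1 : (1 : ℝ) ≤ N := by exact_mod_cast hN
  have hcpos : 0 < c := by rw [hc]; apply div_pos <;> linarith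
  by_contra! hlt
  set L := Real.log (B + 1) - barrierProfile c l (R ^ 2) with hL
  set v : EuclideanSpace ℝ (Fin N) × ℝ → ℝ := fun q =>
    Real.exp (L + (p - 1) / p * l ^ 2 * q.2 + barrierProfile c l (‖q.1 - x₀‖ ^ 2)) with hv
  have hHcont : ∀ q : ℝ, 0 ≤ q → ContinuousAt (barrierProfile c l) q := fun q hq =>
    (hasDerivAt_barrierProfile hcpos (by positivity)).continuousAt
  obtain ⟨R', hR'pos, hR'R, hR'⟩ : ∃ R', 0 < R' ∧ R' < R ∧
      B < Real.exp (L + barrierProfile c l (R' ^ 2)) := by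
    have hca : ContinuousAt (fun s => Real.exp (L + barrierProfile c l (s ^ 2))) R :=
      Real.continuous_exp.continuousAt.comp (continuousAt_const.add
        ((hHcont (R ^ 2) (by positivity)).comp (f := fun s : ℝ => s ^ 2) (by fun_prop)))
    have hval : B < Real.exp (L + barrierProfile c l (R ^ 2)) := by
      rw [hL, sub_add_cancel, Real.exp_log (by linarith)]
      linarith
    have hev := (hca.eventually_const_lt hval).filter_mono nhdsWithin_le_nhds
      |>.and (Ioo_mem_nhdsLT hR)
    obtain ⟨s, hs, hs'⟩ := hev.exists
    exact ⟨s, hs'.1, hs'.2, hs⟩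
  have hvpos : ∀ q, 0 < v q := fun q => Real.exp_pos _
  set δ := w x₀ T - v (x₀, T) with hδ
  have hδpos : 0 < δ := by
    simp only [hδ, hv, sub_self, norm_zero]
    norm_num
    exact hlt
  set σ := min (1 / 2) (δ / 2 / (B + 1)) with hσ
  have hσpos : 0 < σ := lt_min (by norm_num) (by positivity)
  have hσ1 : σ ≤ 1 / 2 := min_le_left _ _
  have hσB : B + 1 ≤ δ / 2 / σ := by
    rw [le_div_iff₀ hσpos, mul_comm, ← le_div_iff₀ (by linarith)]
    exact min_le_right _ _
  set φ : EuclideanSpace ℝ (Fin N) × ℝ → ℝ := fun q => v q + δ / 2 / (T + 1 - q.2) with hφ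
  set S := closedBall x₀ R' ×ˢ Icc 0 (T + 1 - σ) with hS
  have hSΩ : closedBall x₀ R' ⊆ Ω := (closedBall_subset_ball hR'R).trans hball
  have hScomp : IsCompact S := (isCompact_closedBall x₀ R').prod isCompact_Icc
  have hmem : (x₀, T) ∈ S :=
    ⟨mem_closedBall_self hR'pos.le, hT.le, by simp only; linarith⟩
  have hvcont : Continuous v := by
    refine Real.continuous_exp.comp (Continuous.add (by fun_prop) ?_)
    refine continuous_iff_continuousAt.2 fun q => ?_
    exact (hHcont _ (by positivity)).comp
      (f := fun q : EuclideanSpace ℝ (Fin N) × ℝ => ‖q.1 - x₀‖ ^ 2) (by fun_prop)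
  have hpen : ContinuousOn (fun q : EuclideanSpace ℝ (Fin N) × ℝ => δ / 2 / (T + 1 - q.2)) S :=
    continuousOn_const.div (by fun_prop) fun q hq => by linarith [hq.2.2]
  have hfcont : ContinuousOn
      (fun q : EuclideanSpace ℝ (Fin N) × ℝ => w q.1 q.2 - φ q) S :=
    (hcont.mono (prod_mono hSΩ fun s hs => hs.1)).sub (hvcont.continuousOn.add hpen)
  obtain ⟨⟨x₁, t₁⟩, hx₁, hmax⟩ := hScomp.exists_isMaxOn ⟨_, hmem⟩ hfcont
  obtain ⟨hx₁R, ht₁0, ht₁σ⟩ := hx₁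
  simp only at hx₁R ht₁0 ht₁σ
  have hx₁Ω : x₁ ∈ Ω := hSΩ hx₁R
  have hval : δ / 2 ≤ w x₁ t₁ - φ (x₁, t₁) := by
    have h : w x₀ T - φ (x₀, T) ≤ w x₁ t₁ - φ (x₁, t₁) := hmax hmem
    have h' : φ (x₀, T) = v (x₀, T) + δ / 2 := by simp [hφ]
    linarith
  have hφval : φ (x₁, t₁) = v (x₁, t₁) + δ / 2 / (T + 1 - t₁) := rfl
  have hpenpos : 0 < δ / 2 / (T + 1 - t₁) := by
    have : 0 < T + 1 - t₁ := by linarith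
    positivity
  have hv₁ := hvpos (x₁, t₁)
  have ht₁ : 0 < t₁ := by
    refine lt_of_le_of_ne ht₁0 fun heq => ?_
    rw [← heq] at hval hφval hpenpos hv₁
    linarith [hinit x₁ hx₁Ω]
  have ht₁σ' : t₁ < T + 1 - σ := by
    refine lt_of_le_of_ne ht₁σ fun heq => ?_
    have h1 : T + 1 - t₁ = σ := by linarith
    rw [h1] at hφval
    linarith [hB x₁ hx₁Ω t₁ ht₁0]
  have hx₁R' : x₁ ∈ ball x₀ R' := by
    rw [mem_closedBall, dist_eq_norm] at hx₁R
    rw [mem_ball, dist_eq_norm]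
    refine lt_of_le_of_ne hx₁R fun heq => ?_
    have h1 : Real.exp (L + barrierProfile c l (R' ^ 2)) ≤ v (x₁, t₁) := by
      simp only [hv, heq]
      apply Real.exp_le_exp.2
      have : 0 ≤ (p - 1) / p * l ^ 2 * t₁ := by positivity
      linarith
    linarith [hB x₁ hx₁Ω t₁ ht₁0]
  have hnhds : S ∈ 𝓝 (x₁, t₁) := prod_mem_nhds
    (Filter.mem_of_superset (isOpen_ball.mem_nhds hx₁R') ball_subset_closedBall)
    (Icc_mem_nhds ht₁ ht₁σ')
  exact hw.not_isLocalMax_barrier hN hp hc hx₁Ω hl ht₁ (by linarith) (half_pos hδpos)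
    (hmax.isLocalMax hnhds)

theorem sub_log_le_barrierProfile_sub {c l R : ℝ} (hc : 0 < c) (hl : 0 < l) (hR : 0 ≤ R) :
    l * R - c / 2 - c / 2 * Real.log (1 + l * R / c) ≤
      barrierProfile c l (R ^ 2) - barrierProfile c l 0 := by
  have h0 : √(c ^ 2 + 4 * l ^ 2 * 0) = c := by
    rw [mul_zero, add_zero, Real.sqrt_sq hc.le]
  have hlow : 2 * (l * R) ≤ √(c ^ 2 + 4 * l ^ 2 * R ^ 2) :=
    Real.le_sqrt_of_sq_le (by nlinarith [sq_nonneg c])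
  have hup : √(c ^ 2 + 4 * l ^ 2 * R ^ 2) ≤ c + 2 * (l * R) := by
    have : 0 ≤ c * (l * R) := by positivity
    exact Real.sqrt_le_iff.2 ⟨by positivity, by nlinarith⟩
  have hlog : Real.log (c + √(c ^ 2 + 4 * l ^ 2 * R ^ 2)) ≤
      Real.log (c + c) + Real.log (1 + l * R / c) := by
    rw [← Real.log_mul (by positivity) (by positivity)]
    refine Real.log_le_log (by positivity) ?_
    rw [show (c + c) * (1 + l * R / c) = c + (c + 2 * (l * R)) by field_simp; ring]
    linarith
  rw [barrierProfile, barrierProfile, h0]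
  have := mul_le_mul_of_nonneg_left hlog hc.le
  linarith

theorem IsViscositySol.log_le_of_ball_subset {N : ℕ} (hN : 0 < N) {p : ℝ} (hp : 1 < p)
    {Ω : Set (EuclideanSpace ℝ (Fin N))} {w : EuclideanSpace ℝ (Fin N) → ℝ → ℝ}
    (hw : IsViscositySol p Ω w)
    (hcont : ContinuousOn (fun q : EuclideanSpace ℝ (Fin N) × ℝ => w q.1 q.2) (Ω ×ˢ Ici 0))
    {B : ℝ} (hB0 : 0 ≤ B) (hB : ∀ x ∈ Ω, ∀ t : ℝ, 0 ≤ t → w x t ≤ B)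
    (hinit : ∀ x ∈ Ω, w x 0 = 0)
    {c k : ℝ} (hc : c = (N + p - 2) / (p - 1)) (hk : k = (p - 1) / p)
    {x : EuclideanSpace ℝ (Fin N)} {d D : ℝ} (hd : 0 < d) (hdD : d ≤ D) (hball : ball x d ⊆ Ω)
    {t : ℝ} (ht : 0 < t) (ht1 : t < 1) (hpos : 0 < w x t) :
    4 * t * Real.log (w x t) + p / (p - 1) * d ^ 2 ≤
      4 * t * (Real.log (B + 1) + c / 2 +
        c / 2 * (Real.log (1 + D ^ 2 / (2 * k * c)) - Real.log t)) := by
  have hp1 : 0 < p - 1 := by linarith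
  have hN1 : (1 : ℝ) ≤ N := by exact_mod_cast hN
  have hcpos : 0 < c := by rw [hc]; apply div_pos <;> linarith
  have hkpos : 0 < k := by rw [hk]; apply div_pos <;> linarith
  set l := d / (2 * k * t) with hl
  have hlpos : 0 < l := by positivity
  have h1 := hw.le_barrier hN hp hcont hB0 hB hinit hc hlpos hd hball ht
  rw [← Real.log_le_iff_le_exp hpos, ← hk] at h1
  have h2 := sub_log_le_barrierProfile_sub hcpos hlpos hd.le
  have h3 : Real.log (1 + l * d / c) ≤ Real.log (1 + D ^ 2 / (2 * k * c)) - Real.log t := by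
    rw [← Real.log_div (by positivity) ht.ne']
    refine Real.log_le_log (by positivity) ?_
    rw [add_div]
    refine add_le_add ((one_le_div ht).2 ht1.le) ?_
    have : l * d / c = d ^ 2 / (2 * k * c) / t := by rw [hl]; field_simp
    rw [this]
    gcongr
  have h4 : 4 * t * (k * l ^ 2 * t - l * d) = -(p / (p - 1) * d ^ 2) := by
    rw [hl, hk]
    field_simp
    ring
  have h5 : Real.log (w x t) ≤ (k * l ^ 2 * t - l * d) + (Real.log (B + 1) + c / 2 +
      c / 2 * (Real.log (1 + D ^ 2 / (2 * k * c)) - Real.log t)) := by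
    have := mul_le_mul_of_nonneg_left h3 (half_pos hcpos).le
    linarith
  have h6 := mul_le_mul_of_nonneg_left h5 (show 0 ≤ 4 * t by positivity)
  rw [mul_add, h4] at h6
  linarith

theorem IsViscositySol.le_log_of_exterior_ball {N : ℕ} (hN : 0 < N) {p : ℝ} (hp : 1 < p)
    {Ω : Set (EuclideanSpace ℝ (Fin N))} (hΩ : IsOpen Ω) {w : EuclideanSpace ℝ (Fin N) → ℝ → ℝ}
    (hw : IsViscositySol p Ω w)
    (hcont : ContinuousOn (fun q : EuclideanSpace ℝ (Fin N) × ℝ => w q.1 q.2)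
      (closure Ω ×ˢ Ioi 0)) {m : ℝ} (hm : 0 < m)
    (hbd : ∀ y ∈ frontier Ω, ∀ t : ℝ, 0 < t → m ≤ w y t)
    (hpos : ∀ x ∈ Ω, ∀ t : ℝ, 0 < t → 0 < w x t)
    {a β : ℝ} (ha : a = (N + p - 2) / (2 * (p - 1))) (hβ : β = p / (4 * (p - 1)))
    {z : EuclideanSpace ℝ (Fin N)} {ρ : ℝ} (hρ : 0 < ρ) (hz : ∀ q ∈ closure Ω, ρ ≤ ‖q - z‖)
    {x : EuclideanSpace ℝ (Fin N)} (hx : x ∈ Ω) {t d D : ℝ} (ht : 0 < t) (ht1 : t < 1)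
    (hdD : d ≤ D) (hxz : ‖x - z‖ ≤ d + t) :
    -(4 * t * (-Real.log m - a * Real.log (β / a) - 2 * a * Real.log ρ + 2 * β * D + β)) ≤
      4 * t * Real.log (w x t) + p / (p - 1) * d ^ 2 := by
  have hp1 : 0 < p - 1 := by linarith
  have hβpos : 0 < β := by rw [hβ]; positivity
  have hN1 : (1 : ℝ) ≤ N := by exact_mod_cast hN
  have hapos : 0 < a := by rw [ha]; apply div_pos <;> linarith
  have h1 := hw.kernel_le_log hN hp hΩ hcont hm hbd hpos ha hβ hρ hz hx ht
  have h2 : Real.log (β * ρ ^ 2 / a) = Real.log (β / a) + 2 * Real.log ρ := by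
    rw [mul_div_right_comm, Real.log_mul (by positivity) (by positivity), Real.log_pow]
    norm_num
  have h3 : β * ‖x - z‖ ^ 2 / t ≤ β * d ^ 2 / t + 2 * β * D + β := by
    calc β * ‖x - z‖ ^ 2 / t ≤ β * (d + t) ^ 2 / t := by gcongr
      _ = β * d ^ 2 / t + 2 * β * d + β * t := by field_simp; ring
      _ ≤ β * d ^ 2 / t + 2 * β * D + β := by nlinarith
  have h4 : 4 * t * (β * d ^ 2 / t) = p / (p - 1) * d ^ 2 := by
    rw [hβ]
    field_simp
  have h5 : a * Real.log t ≤ 0 :=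
    mul_nonpos_of_nonneg_of_nonpos hapos.le (Real.log_nonpos ht.le ht1.le)
  have h6 : -(-Real.log m - a * Real.log (β / a) - 2 * a * Real.log ρ + 2 * β * D + β) -
      β * d ^ 2 / t ≤ Real.log (w x t) := by
    rw [h2] at h1
    linarith
  have h7 := mul_le_mul_of_nonneg_left h6 (show 0 ≤ 4 * t by positivity)
  rw [mul_sub, h4] at h7
  linarith

section Modulus

variable {ω : ℝ → ℝ} {r t : ℝ}

/-- Distance from `(0, t)` to the part of the graph of `ω` over `[0, r]`. -/
noncomputable def graphDist (ω : ℝ → ℝ) (r t : ℝ) : ℝ :=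
  sInf ((fun s => Real.sqrt (s ^ 2 + (t - ω s) ^ 2)) '' Set.Icc 0 r)

theorem graphDist_le {s : ℝ} (hs : s ∈ Icc 0 r) :
    graphDist ω r t ≤ √(s ^ 2 + (t - ω s) ^ 2) :=
  csInf_le ⟨0, by rintro _ ⟨s, -, rfl⟩; exact Real.sqrt_nonneg _⟩ ⟨s, hs, rfl⟩

theorem graphDist_le_self (hω0 : ω 0 = 0) (hr : 0 ≤ r) (ht : 0 ≤ t) : graphDist ω r t ≤ t := by
  refine (graphDist_le (s := 0) ⟨le_rfl, hr⟩).trans_eq ?_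
  simp [hω0, Real.sqrt_sq ht]

theorem graphDist_pos (hω0 : ω 0 = 0) (hωlim : Tendsto ω (𝓝[>] (0 : ℝ)) (𝓝 0)) (hr : 0 ≤ r)
    (ht : 0 < t) : 0 < graphDist ω r t := by
  obtain ⟨ε, hε, hεω⟩ := mem_nhdsGT_iff_exists_Ioo_subset.1
    (hωlim.eventually_lt_const (half_pos ht))
  refine lt_of_lt_of_le (lt_min (half_pos ht) hε) (le_csInf ⟨_, 0, ⟨le_rfl, hr⟩, rfl⟩ ?_)
  rintro _ ⟨s, ⟨hs0, -⟩, rfl⟩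
  by_cases hsε : s < ε
  · refine (min_le_left _ _).trans (Real.le_sqrt_of_sq_le ?_)
    have hωs : ω s ≤ t / 2 := by
      rcases hs0.eq_or_lt with rfl | hs
      · rw [hω0]; positivity
      · exact (hεω ⟨hs, hsε⟩ : ω s < t / 2).le
    nlinarith [sq_nonneg s]
  · refine (min_le_right _ _).trans ((not_lt.1 hsε).trans (Real.le_sqrt_of_sq_le ?_))
    nlinarith [sq_nonneg (t - ω s)]

theorem graphDist_le_of_le (hω0 : ω 0 = 0) (hωcont : ContinuousOn ω (Ioi 0))
    (hωlim : Tendsto ω (𝓝[>] (0 : ℝ)) (𝓝 0)) (ht : 0 ≤ t) {s : ℝ} (hs : s ∈ Icc 0 r)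
    (hts : t ≤ ω s) : graphDist ω r t ≤ s := by
  have hcont : ContinuousOn ω (Icc 0 s) := by
    intro u hu
    rcases hu.1.eq_or_lt with rfl | hu0
    · refine ContinuousWithinAt.mono ?_ (Icc_subset_Ici_self)
      rw [← continuousWithinAt_Ioi_iff_Ici, ContinuousWithinAt, hω0]
      exact hωlim
    · exact (hωcont.continuousAt (Ioi_mem_nhds hu0)).continuousWithinAt
  obtain ⟨u, hu, hut⟩ := intermediate_value_Icc hs.1 hcont ⟨by rw [hω0]; exact ht, hts⟩
  refine (graphDist_le (s := u) ⟨hu.1, hu.2.trans hs.2⟩).trans ?_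
  rw [hut, sub_self, zero_pow two_ne_zero, add_zero, Real.sqrt_sq hu.1]
  exact hu.2

end Modulus

theorem dist_sq_eq_proj {N : ℕ} {iN : Fin N} (hiN : (iN : ℕ) = N - 1)
    (g : EuclideanSpace ℝ (Fin N) ≃ᵢ EuclideanSpace ℝ (Fin N)) (y q : EuclideanSpace ℝ (Fin N)) :
    dist y q ^ 2 = dist (proj g y) (proj g q) ^ 2 + (g y iN - g q iN) ^ 2 := by
  rw [← g.dist_eq y q, dist_eq_norm, dist_eq_norm, EuclideanSpace.real_norm_sq_eq,
    EuclideanSpace.real_norm_sq_eq]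
  obtain _ | n := N
  · exact iN.elim0
  · have hlast : iN = Fin.last n := Fin.ext (by simpa using hiN)
    subst hlast
    exact Fin.sum_univ_castSucc _

/-- Every boundary point has, at distance `t`, the centre of an exterior ball of radius
`graphDist ω r t`. -/
theorem IsC0omega.exists_exterior_ball {N : ℕ} {Ω : Set (EuclideanSpace ℝ (Fin N))}
    (hΩ : IsOpen Ω) {ω : ℝ → ℝ} (hω0 : ω 0 = 0) (hωcont : ContinuousOn ω (Ioi 0))
    (hωlim : Tendsto ω (𝓝[>] (0 : ℝ)) (𝓝 0)) {r : ℝ} {iN : Fin N} (hiN : (iN : ℕ) = N - 1)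
    (hreg : IsC0omega Ω ω r iN) {y : EuclideanSpace ℝ (Fin N)} (hy : y ∈ frontier Ω)
    {t : ℝ} (ht : 0 < t) (htr : t < r / 2) :
    ∃ z, ‖y - z‖ = t ∧ ∀ q ∈ closure Ω, graphDist ω r t ≤ ‖q - z‖ := by
  obtain ⟨hr, hreg⟩ := hreg
  obtain ⟨g, φb, hin, hfr, hmod⟩ := hreg y hy
  set z := g.symm (g y + EuclideanSpace.single iN t) with hzdef
  have hgz : g z = g y + EuclideanSpace.single iN t := g.apply_symm_apply _
  have hzN : g z iN = g y iN + t := by simp [hgz]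
  have hzy : dist y z = t := by
    rw [← g.dist_eq, hgz, dist_eq_norm]
    simp [abs_of_pos ht]
  have hproj : proj g z = proj g y := by
    have h := dist_sq_eq_proj hiN g y z
    rw [hzy, hzN] at h
    have h0 : dist (proj g y) (proj g z) ^ 2 = 0 := by linarith
    exact (dist_eq_zero.1 (pow_eq_zero_iff two_ne_zero |>.1 h0)).symm
  have hyball : y ∈ ball y r := mem_ball_self hr
  have hyN : g y iN = φb (proj g y) := (hfr y hyball).1 hy
  have hψt : graphDist ω r t ≤ t := graphDist_le_self hω0 hr.le ht.le
  have hboundary : ∀ q ∈ frontier Ω, graphDist ω r t ≤ dist q z := by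
    intro q hq
    by_contra! hlt
    have hqy : dist q y < r := by
      have := dist_triangle q z y
      rw [dist_comm z y, hzy] at this
      linarith
    have hqN := (hfr q hqy).1 hq
    have hm := hmod q ⟨hqy, hq⟩ y ⟨hyball, hy⟩
    rw [← hqN, ← hyN] at hm
    set s := dist (proj g q) (proj g y) with hs
    have hdist := dist_sq_eq_proj hiN g q z
    rw [hproj, hzN, ← hs] at hdist
    have hsr : s ≤ r := by
      have h := dist_sq_eq_proj hiN g q y
      refine le_trans ?_ hqy.le
      exact abs_le_of_sq_le_sq' (by rw [h]; nlinarith [sq_nonneg (g q iN - g y iN)])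
        dist_nonneg |>.2
    have hs0 : 0 ≤ s := dist_nonneg
    refine absurd hlt (not_lt.2 ?_)
    by_cases hωt : t ≤ ω s
    · refine (graphDist_le_of_le hω0 hωcont hωlim ht.le ⟨hs0, hsr⟩ hωt).trans ?_
      exact abs_le_of_sq_le_sq' (by rw [hdist]; nlinarith [sq_nonneg (g q iN - (g y iN + t))])
        dist_nonneg |>.2
    · refine (graphDist_le ⟨hs0, hsr⟩).trans (Real.sqrt_le_iff.2 ⟨dist_nonneg, ?_⟩)
      rw [hdist]
      have h1 := (abs_le.1 hm).2
      nlinarith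
  have hzΩ : z ∉ Ω := by
    intro hz
    have hzball : z ∈ ball y r := by
      rw [mem_ball, dist_comm, hzy]
      linarith
    have := (hin z hzball).1 hz
    rw [hproj, ← hyN, hzN] at this
    linarith
  refine ⟨z, by rw [← dist_eq_norm, hzy], fun q hq => ?_⟩
  rw [← dist_eq_norm]
  by_contra! hlt
  have hqΩ : q ∈ Ω := by
    by_contra hnot
    exact absurd hlt (not_lt.2 (hboundary q (by rw [hΩ.frontier_eq]; exact ⟨hq, hnot⟩)))
  have hsub : ball z (graphDist ω r t) ⊆ Ω := by
    refine (convex_ball z _).isPreconnected.subset_of_closure_inter_subset hΩ ⟨q, hlt, hqΩ⟩ ?_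
    rintro q' ⟨hq', hq'ball⟩
    by_contra hnot
    exact absurd hq'ball (not_lt.2 (hboundary q' (by rw [hΩ.frontier_eq]; exact ⟨hq', hnot⟩)))
  exact hzΩ (hsub (mem_ball_self (dist_nonneg.trans_lt hlt)))

/-- the uniform short-time estimate holds for solutions with positive,
bounded (possibly non-constant) boundary data `h̲ ≤ w ≤ h̄` on `Γ × (0,∞)`. -/
theorem stmt11 (N : ℕ) (hN : 2 ≤ N) (p : ℝ) (hp : 1 < p)
    (Ω : Set (EuclideanSpace ℝ (Fin N))) (hΩo : IsOpen Ω) (hΩc : IsConnected Ω)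
    (hΓ : (frontier Ω).Nonempty)
    (ω : ℝ → ℝ) (hω0 : ω 0 = 0) (hωpos : ∀ s : ℝ, 0 < s → 0 < ω s)
    (hωmono : StrictMonoOn ω (Set.Ioi 0)) (hωcont : ContinuousOn ω (Set.Ioi 0))
    (hωlim : Filter.Tendsto ω (𝓝[>] (0:ℝ)) (𝓝 0))
    (r : ℝ) (iN : Fin N) (hiN : (iN : ℕ) = N - 1)
    (hreg : IsC0omega Ω ω r iN)
    (ψ : ℝ → ℝ)
    (hψ : ∀ t : ℝ, ψ t = sInf ((fun s => Real.sqrt (s^2 + (t - ω s)^2)) '' Set.Icc 0 r))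
    (hlow hupp : ℝ) (hbpos : 0 < hlow) (hble : hlow ≤ hupp)
    (w : EuclideanSpace ℝ (Fin N) → ℝ → ℝ)
    (hwbdd : ∃ M : ℝ, ∀ x ∈ closure Ω, ∀ t : ℝ, 0 ≤ t → |w x t| ≤ M)
    (hwcont : ∀ x ∈ closure Ω, ∀ t : ℝ, 0 ≤ t → ¬(x ∈ frontier Ω ∧ t = 0) →
      ContinuousWithinAt (fun q : EuclideanSpace ℝ (Fin N) × ℝ => w q.1 q.2)
        (closure Ω ×ˢ Set.Ici 0) (x, t))
    (hwvisc : IsViscositySol p Ω w)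
    (hwinit : ∀ x ∈ Ω, w x 0 = 0)
    (hwbdry : ∀ y ∈ frontier Ω, ∀ t : ℝ, 0 < t → hlow ≤ w y t ∧ w y t ≤ hupp)
    (hwpos : ∀ x ∈ Ω, ∀ t : ℝ, 0 < t → 0 < w x t) :
    ∀ K : Set (EuclideanSpace ℝ (Fin N)), IsCompact K → K ⊆ closure Ω →
      ∃ C : ℝ, 0 < C ∧ ∃ t₀ : ℝ, 0 < t₀ ∧ ∀ x ∈ K, ∀ t : ℝ, 0 < t → t < t₀ →
        |4 * t * Real.log (w x t) + (p/(p-1)) * (Metric.infDist x (frontier Ω))^2| ≤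
          C * t * (1 + |Real.log (ψ t)|) := by
  obtain ⟨B', hB'⟩ := hwbdd
  set B := |B'| with hBdef
  have hB0 : 0 ≤ B := abs_nonneg _
  have hB : ∀ x ∈ Ω, ∀ t : ℝ, 0 ≤ t → w x t ≤ B := fun x hx t ht =>
    (le_abs_self _).trans ((hB' x (subset_closure hx) t ht).trans (le_abs_self _))
  have hN0 : 0 < N := by omega
  have hN1 : (1 : ℝ) ≤ N := by exact_mod_cast hN0
  have hp1 : 0 < p - 1 := by linarith
  have hr : 0 < r := hreg.1
  have hcont0 : ContinuousOn (fun q : EuclideanSpace ℝ (Fin N) × ℝ => w q.1 q.2)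
      (Ω ×ˢ Ici 0) := by
    rintro ⟨x, t⟩ ⟨hx, ht⟩
    refine (hwcont x (subset_closure hx) t ht fun h => ?_).mono
      (prod_mono subset_closure subset_rfl)
    exact (hΩo.frontier_eq ▸ h.1 : x ∈ closure Ω \ Ω).2 hx
  have hcont1 : ContinuousOn (fun q : EuclideanSpace ℝ (Fin N) × ℝ => w q.1 q.2)
      (closure Ω ×ˢ Ioi 0) := by
    rintro ⟨x, t⟩ ⟨hx, ht⟩
    exact (hwcont x hx t (le_of_lt ht) fun h => (ne_of_gt ht) h.2).mono
      (prod_mono subset_rfl Ioi_subset_Ici_self)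
  intro K hK hKΩ
  obtain ⟨y₀, hy₀⟩ := hΓ
  obtain ⟨D', hD'⟩ := hK.isBounded.subset_closedBall y₀
  set D := |D'| with hDdef
  have hD0 : 0 ≤ D := abs_nonneg _
  have hD : ∀ x ∈ K, infDist x (frontier Ω) ≤ D := fun x hx =>
    (infDist_le_dist_of_mem hy₀).trans ((hD' hx).trans (le_abs_self _))
  set a : ℝ := (N + p - 2) / (2 * (p - 1)) with ha
  set c : ℝ := (N + p - 2) / (p - 1) with hc
  set k : ℝ := (p - 1) / p with hk
  set β : ℝ := p / (4 * (p - 1)) with hβ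
  have hapos : 0 < a := by apply div_pos <;> linarith
  have hcpos : 0 < c := by apply div_pos <;> linarith
  have hkpos : 0 < k := by apply div_pos <;> linarith
  have hβpos : 0 < β := by apply div_pos <;> linarith
  set Cbd := |Real.log hlow| + |Real.log hupp| with hCbd
  set Cup := |Real.log (B + 1)| + c / 2 + c / 2 * |Real.log (1 + D ^ 2 / (2 * k * c))| + c / 2
    with hCup
  set Clo := |Real.log hlow| + a * |Real.log (β / a)| + 2 * a + 2 * β * D + β with hClo
  have hCbd0 : 0 ≤ Cbd := by positivity
  have hCup0 : 0 < Cup := by positivity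
  have hClo0 : 0 ≤ Clo := by positivity
  refine ⟨4 * (Cbd + Cup + Clo), by positivity, min 1 (r / 2), by positivity, ?_⟩
  intro x hxK t ht htt
  have ht1 : t < 1 := htt.trans_le (min_le_left _ _)
  have htr : t < r / 2 := htt.trans_le (min_le_right _ _)
  have hψt : ψ t = graphDist ω r t := hψ t
  have hψpos : 0 < ψ t := hψt ▸ graphDist_pos hω0 hωlim hr.le ht
  have hψle : ψ t ≤ t := hψt ▸ graphDist_le_self hω0 hr.le ht.le
  have hlog : Real.log (ψ t) ≤ Real.log t := Real.log_le_log hψpos hψle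
  have hlogt : Real.log t ≤ 0 := Real.log_nonpos ht.le ht1.le
  set ℓ := |Real.log (ψ t)| with hℓ
  have hℓeq : ℓ = -Real.log (ψ t) := abs_of_nonpos (hlog.trans hlogt)
  have hℓ0 : 0 ≤ ℓ := abs_nonneg _
  have hweaken : ∀ A C' : ℝ, A ≤ C' * (1 + ℓ) → C' ≤ Cbd + Cup + Clo →
      4 * t * A ≤ 4 * (Cbd + Cup + Clo) * t * (1 + ℓ) := by
    intro A C' hA hC'
    have h1 : A ≤ (Cbd + Cup + Clo) * (1 + ℓ) := hA.trans (by gcongr)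
    have h2 := mul_le_mul_of_nonneg_left h1 (show 0 ≤ 4 * t by positivity)
    linarith
  by_cases hxΩ : x ∈ Ω
  · set d := infDist x (frontier Ω) with hd
    have hxfr : x ∉ frontier Ω := fun h => (hΩo.frontier_eq ▸ h : x ∈ closure Ω \ Ω).2 hxΩ
    have hdpos : 0 < d := (isClosed_frontier.notMem_iff_infDist_pos ⟨y₀, hy₀⟩).1 hxfr
    have hball : ball x d ⊆ Ω := by
      refine (convex_ball x d).isPreconnected.subset_of_closure_inter_subset hΩo
        ⟨x, mem_ball_self hdpos, hxΩ⟩ ?_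
      rintro q ⟨hq, hqball⟩
      by_contra hnot
      exact ball_infDist_subset_compl hqball (by rw [hΩo.frontier_eq]; exact ⟨hq, hnot⟩)
    obtain ⟨y, hy, hxy⟩ := isClosed_frontier.exists_infDist_eq_dist ⟨y₀, hy₀⟩ x
    obtain ⟨z, hyz, hz⟩ := hreg.exists_exterior_ball hΩo hω0 hωcont hωlim hiN hy ht htr
    rw [← hψt] at hz
    have hxz : ‖x - z‖ ≤ d + t := by
      rw [hd, hxy, ← hyz, ← dist_eq_norm, ← dist_eq_norm]
      exact dist_triangle _ _ _
    have hupper := hwvisc.log_le_of_ball_subset hN0 hp hcont0 hB0 hB hwinit hc hk hdpos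
      (hD x hxK) hball ht ht1 (hwpos x hxΩ t ht)
    have hlower := hwvisc.le_log_of_exterior_ball hN0 hp hΩo hcont1 hbpos
      (fun y hy t ht => (hwbdry y hy t ht).1) hwpos ha hβ hψpos hz hxΩ ht ht1 (hD x hxK) hxz
    rw [abs_le]
    constructor
    · refine le_trans (neg_le_neg (hweaken _ Clo ?_ (by linarith))) hlower
      have h1 := neg_abs_le (Real.log hlow)
      have h2 := mul_le_mul_of_nonneg_left (neg_abs_le (Real.log (β / a))) hapos.le
      have h3 : 0 ≤ (Clo - 2 * a) * ℓ := mul_nonneg (by rw [hClo]; ring_nf; positivity) hℓ0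
      have h4 : 2 * a * Real.log (ψ t) = -(2 * a * ℓ) := by rw [hℓeq]; ring
      linarith
    · refine hupper.trans (hweaken _ Cup ?_ (by linarith))
      have h1 := le_abs_self (Real.log (B + 1))
      have h2 := mul_le_mul_of_nonneg_left (le_abs_self (Real.log (1 + D ^ 2 / (2 * k * c))))
        (half_pos hcpos).le
      have h3 : 0 ≤ (Cup - c / 2) * ℓ :=
        mul_nonneg (by rw [hCup, add_sub_cancel_right]; positivity) hℓ0
      have h4 := mul_le_mul_of_nonneg_left (show -Real.log t ≤ ℓ by linarith) (half_pos hcpos).le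
      linarith
  · have hxfr : x ∈ frontier Ω := by
      rw [hΩo.frontier_eq]
      exact ⟨hKΩ hxK, hxΩ⟩
    obtain ⟨hw1, hw2⟩ := hwbdry x hxfr t ht
    have h1 : Real.log hlow ≤ Real.log (w x t) := Real.log_le_log hbpos hw1
    have h2 : Real.log (w x t) ≤ Real.log hupp := Real.log_le_log (hbpos.trans_le hw1) hw2
    have h3 : |Real.log (w x t)| ≤ Cbd := by
      rw [abs_le]
      constructor
      · linarith [neg_abs_le (Real.log hlow), abs_nonneg (Real.log hupp)]
      · linarith [le_abs_self (Real.log hupp), abs_nonneg (Real.log hlow)]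
    rw [infDist_zero_of_mem hxfr, zero_pow two_ne_zero, mul_zero, add_zero, abs_mul,
      abs_of_pos (show 0 < 4 * t by positivity)]
    exact hweaken _ Cbd (by nlinarith) (by linarith)

end
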